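/- Fix d, m ∈ ℕ, ω₀ > 0, ω_f ∈ ℝ, B ∈ ℂ^{d×m}, and constants C, α, M > 0. For each n ∈ ℕ let Ĵ^{(n)} : ℤ → ℂ^{d×d} be a family of matrices, and let L^{(n)} ∈ ℂ^{(2n+1)d×(2n+1)d} be the block matrix with blocks indexed by k, ℓ ∈ {−n, …, n} given by L^{(n)}_{kk} = i(ω_f + kω₀)I_d − Ĵ₀^{(n)} on the diagonal and L^{(n)}_{kℓ} = −Ĵ^{(n)}_{k−ℓ} for k ≠ ℓ; let B^{(n)} ∈ ℂ^{(2n+1)d×m} have block B in the row k = 0 and zero blocks elsewhere, and set R^{(n)} = (L^{(n)})^{−1} B^{(n)}. Assume: (J1) ‖Ĵ^{(n)}_k‖₂ ≤ C e^{−α|k|} for all n and all k; (J2) ‖Ĵ^{(m)}_k − Ĵ^{(n)}_k‖₂ ≤ C e^{−αn} for all m ≥ n and all |k| ≤ n; (J3) every L^{(n)} is invertible with ‖(L^{(n)})^{−1}‖₂ ≤ M. Then for every α' with 0 < α' < α there exists C₂ > 0 such that for all m > n, |σ₁(R^{(m)}) − σ₁(R^{(n)})| ≤ C₂ e^{−α'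 n}. -/

import Mathlib

/-- The operator norm of a complex matrix induced by the Euclidean (`ℓ²`) vector norms.
This equals the largest singular value `σ₁`. -/
noncomputable def opNorm {a b : Type*} [Fintype a] [Fintype b] [DecidableEq b]
    (A : Matrix a b ℂ) : ℝ :=
  ‖LinearMap.toContinuousLinearMap (Matrix.toEuclideanLin A)‖

/-- The wavenumber `k ∈ {-n, …, n}` associated with the `j`-th block row/column. -/
def wn (n : ℕ) (j : Fin (2 * n + 1)) : ℤ := (j : ℤ) - (n : ℤ)

/-- The truncated harmonic resolvent operator `L^{(n)}`: block matrix with blocks indexed by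
wavenumbers `k, ℓ ∈ {-n, …, n}`, with diagonal blocks `i(ω_f + kω₀)I_d - Ĵ₀` and off-diagonal
blocks `-Ĵ_{k-ℓ}`. -/
noncomputable def Lop (d : ℕ) (ω₀ ωf : ℝ) (J : ℤ → Matrix (Fin d) (Fin d) ℂ) (n : ℕ) :
    Matrix (Fin (2 * n + 1) × Fin d) (Fin (2 * n + 1) × Fin d) ℂ :=
  Matrix.of fun p q =>
    (if p = q then Complex.I * ((ωf : ℂ) + (wn n p.1 : ℂ) * (ω₀ : ℂ)) else 0)
      - (J (wn n p.1 - wn n q.1)) p.2 q.2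

/-- The block input matrix `B^{(n)}`, with the block `B` in the row `k = 0` and zeros elsewhere. -/
noncomputable def Bop (d m : ℕ) (B : Matrix (Fin d) (Fin m) ℂ) (n : ℕ) :
    Matrix (Fin (2 * n + 1) × Fin d) (Fin m) ℂ :=
  Matrix.of fun p j => if wn n p.1 = 0 then B p.2 j else 0

open Finset in
lemma hr_geom (γ : ℝ) (hγ : 0 < γ) : ∃ G : ℝ, 0 < G ∧ ∀ (s : Finset ℤ) (k : ℤ),
    ∑ l ∈ s, Real.exp (-γ * |((k - l : ℤ) : ℝ)|) ≤ G := by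
  have hs : Summable (fun l : ℤ => Real.exp (-γ * |(l : ℝ)|)) := by
    have h1 : Summable (fun l : ℕ => Real.exp (-γ * (l : ℝ))) := by
      have := Real.summable_exp_nat_mul_iff.mpr (neg_lt_zero.mpr hγ)
      refine this.congr fun l => ?_
      rw [mul_comm]
    refine Summable.of_nat_of_neg ?_ ?_
    · simpa using h1
    · simpa using h1
  refine ⟨∑' l : ℤ, Real.exp (-γ * |(l : ℝ)|) + 1, ?_, ?_⟩
  · have : 0 ≤ ∑' l : ℤ, Real.exp (-γ * |(l : ℝ)|) := tsum_nonneg (fun l => (Real.exp_pos _).le)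
    linarith
  · intro s k
    have h2 : ∑ l ∈ s, Real.exp (-γ * |((k - l : ℤ) : ℝ)|)
        = ∑ l ∈ s.map (Equiv.subLeft k).toEmbedding, Real.exp (-γ * |(l : ℝ)|) := by
      rw [Finset.sum_map]; rfl
    rw [h2]
    have := hs.sum_le_tsum (s.map (Equiv.subLeft k).toEmbedding) (fun i _ => (Real.exp_pos _).le)
    linarith

noncomputable def tc {a b : Type*} [Fintype a] [Fintype b] [DecidableEq b]
    (A : Matrix a b ℂ) : EuclideanSpace ℂ b →L[ℂ] EuclideanSpace ℂ a :=
  LinearMap.toContinuousLinearMap (Matrix.toEuclideanLin A)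

section
variable {a b c : Type*} [Fintype a] [Fintype b] [DecidableEq b] [Fintype c] [DecidableEq c]

lemma norm_tc (A : Matrix a b ℂ) : ‖tc A‖ = opNorm A := rfl

lemma opNorm_nonneg' (A : Matrix a b ℂ) : 0 ≤ opNorm A := norm_nonneg (tc A)

lemma tc_le (A : Matrix a b ℂ) (v : EuclideanSpace ℂ b) : ‖tc A v‖ ≤ opNorm A * ‖v‖ :=
  (tc A).le_opNorm v

lemma tc_apply (A : Matrix a b ℂ) (v : EuclideanSpace ℂ b) (i : a) :
    tc A v i = ∑ j, A i j * v j := rfl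

lemma tc_mul (A : Matrix a b ℂ) (D : Matrix b c ℂ) (v : EuclideanSpace ℂ c) :
    tc (A * D) v = tc A (tc D v) := by
  ext i
  simp only [tc_apply, Matrix.mul_apply, Finset.sum_mul, Finset.mul_sum]
  rw [Finset.sum_comm]
  simp only [mul_assoc]

lemma tc_sub (A D : Matrix a b ℂ) (v : EuclideanSpace ℂ b) :
    tc (A - D) v = tc A v - tc D v := by
  ext i
  simp [tc_apply, sub_mul, Finset.sum_sub_distrib]

lemma tc_one (v : EuclideanSpace ℂ b) : tc (1 : Matrix b b ℂ) v = v := by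
  ext i
  simp [tc_apply, Matrix.one_apply]
end

noncomputable def res {d : ℕ} (n : ℕ) (X : ℤ → EuclideanSpace ℂ (Fin d)) :
    EuclideanSpace ℂ (Fin (2 * n + 1) × Fin d) :=
  WithLp.toLp 2 fun p => X (wn n p.1) p.2

lemma res_apply {d : ℕ} (n : ℕ) (X : ℤ → EuclideanSpace ℂ (Fin d)) (p) :
    res n X p = X (wn n p.1) p.2 := rfl

lemma sum_wn {E : Type*} [AddCommMonoid E] (n : ℕ) (f : ℤ → E) :
    ∑ j, f (wn n j) = ∑ k ∈ Finset.Icc (-(n : ℤ)) n, f k := by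
  refine Finset.sum_bij (fun j _ => wn n j) ?_ ?_ ?_ ?_
  · intro j _
    have := j.2
    simp only [wn, Finset.mem_Icc]; omega
  · intro i _ j _ h
    simp only [wn] at h
    ext; omega
  · intro k hk
    rw [Finset.mem_Icc] at hk
    refine ⟨⟨(k + n).toNat, by omega⟩, Finset.mem_univ _, ?_⟩
    simp only [wn]; omega
  · intros; rfl

lemma wn_surj (n : ℕ) (k : ℤ) (hk : k ∈ Finset.Icc (-(n : ℤ)) n) : ∃ j, wn n j = k := by
  rw [Finset.mem_Icc] at hk
  refine ⟨⟨(k + n).toNat, by omega⟩, ?_⟩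
  simp only [wn]; omega

lemma wn_mem (n : ℕ) (j) : wn n j ∈ Finset.Icc (-(n : ℤ)) n := by
  have := j.2
  simp only [wn, Finset.mem_Icc]; omega

lemma wn_inj (n : ℕ) (i j) (h : wn n i = wn n j) : i = j := by
  simp only [wn] at h
  ext; omega

lemma norm_res_sq {d : ℕ} (n : ℕ) (X : ℤ → EuclideanSpace ℂ (Fin d)) :
    ‖res n X‖ ^ 2 = ∑ k ∈ Finset.Icc (-(n : ℤ)) n, ‖X k‖ ^ 2 := by
  rw [EuclideanSpace.norm_sq_eq, Fintype.sum_prod_type, ← sum_wn]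
  refine Finset.sum_congr rfl fun j _ => ?_
  rw [EuclideanSpace.norm_sq_eq]
  rfl

lemma norm_res_le {d : ℕ} (n : ℕ) (X : ℤ → EuclideanSpace ℂ (Fin d)) :
    ‖res n X‖ ≤ ∑ k ∈ Finset.Icc (-(n : ℤ)) n, ‖X k‖ := by
  refine (sq_le_sq₀ (norm_nonneg _) (Finset.sum_nonneg fun _ _ => norm_nonneg _)).mp ?_
  rw [norm_res_sq]
  exact Finset.sum_sq_le_sq_sum_of_nonneg (fun _ _ => norm_nonneg _)

lemma le_norm_res {d : ℕ} (n : ℕ) (X : ℤ → EuclideanSpace ℂ (Fin d)) (k : ℤ)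
    (hk : k ∈ Finset.Icc (-(n : ℤ)) n) : ‖X k‖ ≤ ‖res n X‖ := by
  refine (sq_le_sq₀ (norm_nonneg _) (norm_nonneg _)).mp ?_
  rw [norm_res_sq]
  exact Finset.single_le_sum (f := fun k => ‖X k‖ ^ 2) (fun _ _ => by positivity) hk

lemma exists_res {d : ℕ} (n : ℕ) (x : EuclideanSpace ℂ (Fin (2 * n + 1) × Fin d)) :
    ∃ X : ℤ → EuclideanSpace ℂ (Fin d), res n X = x ∧
      ∀ k, k ∉ Finset.Icc (-(n : ℤ)) n → X k = 0 := by
  classical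
  refine ⟨fun k => if h : k ∈ Finset.Icc (-(n : ℤ)) n then
    WithLp.toLp 2 fun i => x ((wn_surj n k h).choose, i) else 0, ?_, ?_⟩
  · ext p
    rw [res_apply, dif_pos (wn_mem n p.1)]
    have := wn_inj n _ _ (wn_surj n _ (wn_mem n p.1)).choose_spec
    simp only [this]
  · intro k hk
    simp only [dif_neg hk]

lemma res_inj {d : ℕ} (n : ℕ) (X Y : ℤ → EuclideanSpace ℂ (Fin d)) (h : res n X = res n Y)
    (k : ℤ) (hk : k ∈ Finset.Icc (-(n : ℤ)) n) : X k = Y k := by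
  obtain ⟨j, rfl⟩ := wn_surj n k hk
  ext i
  have := congrArg (fun z => z (j, i)) h
  simpa [res_apply] using this

lemma tc_Lop {d : ℕ} (ω₀ ωf : ℝ) (J : ℤ → Matrix (Fin d) (Fin d) ℂ) (n : ℕ)
    (X : ℤ → EuclideanSpace ℂ (Fin d)) :
    tc (Lop d ω₀ ωf J n) (res n X) = res n (fun k =>
      (Complex.I * ((ωf : ℂ) + (k : ℂ) * (ω₀ : ℂ))) • X k
        - ∑ l ∈ Finset.Icc (-(n : ℤ)) n, tc (J (k - l)) (X l)) := by
  ext p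
  rw [tc_apply, res_apply, ← sum_wn n (fun l => tc (J (wn n p.1 - l)) (X l))]
  simp only [Lop, Matrix.of_apply, sub_mul, Finset.sum_sub_distrib, res_apply, ite_mul, zero_mul,
    Finset.sum_ite_eq, Finset.mem_univ, if_true, PiLp.sub_apply, PiLp.smul_apply, smul_eq_mul]
  congr 1
  rw [Fintype.sum_prod_type]
  simp [tc_apply]

lemma tc_Bop {d m : ℕ} (B : Matrix (Fin d) (Fin m) ℂ) (n : ℕ) (u : EuclideanSpace ℂ (Fin m)) :
    tc (Bop d m B n) u = res n (fun k => if k = 0 then tc B u else 0) := by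
  ext p
  rw [tc_apply, res_apply]
  by_cases h : wn n p.1 = 0 <;> simp [Bop, h, tc_apply]

lemma res_sub {d : ℕ} (n : ℕ) (X Y : ℤ → EuclideanSpace ℂ (Fin d)) :
    res n X - res n Y = res n (fun k => X k - Y k) := rfl

/-- weighted kernel: exp(-α|k-l|) exp(-β|l|) ≤ exp(-β|k|) exp(-(α-β)|k-l|) -/
lemma exp_kernel (α β : ℝ) (hβ : 0 < β) (k l : ℤ) :
    Real.exp (-α * |((k - l : ℤ) : ℝ)|) * Real.exp (-β * |(l : ℝ)|)
      ≤ Real.exp (-β * |(k : ℝ)|) * Real.exp (-(α - β) * |((k - l : ℤ) : ℝ)|) := by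
  rw [← Real.exp_add, ← Real.exp_add, Real.exp_le_exp]
  have : |(k : ℝ)| ≤ |((k - l : ℤ) : ℝ)| + |(l : ℝ)| := by
    have := abs_add_le ((k - l : ℤ) : ℝ) (l : ℝ)
    push_cast at this ⊢
    simpa using this
  nlinarith

lemma hr_decay {d : ℕ} (ω₀ ωf C α β G Q : ℝ) (hC : 0 < C) (hβ : 0 < β) (hQ : 0 ≤ Q) (hG0 : 0 < G)
    (hG : ∀ (s : Finset ℤ) (k : ℤ), ∑ l ∈ s, Real.exp (-(α - β) * |((k - l : ℤ) : ℝ)|) ≤ G)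
    (K : ℝ) (hK0 : 0 ≤ K) (hK : ∀ k : ℤ, K < |(k : ℝ)| → 2 * C * G ≤ |ωf + k * ω₀|)
    (J : ℤ → Matrix (Fin d) (Fin d) ℂ) (n : ℕ)
    (hJ : ∀ k : ℤ, opNorm (J k) ≤ C * Real.exp (-α * |(k : ℝ)|))
    (X : ℤ → EuclideanSpace ℂ (Fin d))
    (hX : ∀ k ∈ Finset.Icc (-(n : ℤ)) n, ‖X k‖ ≤ Q)
    (heq : ∀ k ∈ Finset.Icc (-(n : ℤ)) n, k ≠ 0 →
      (Complex.I * ((ωf : ℂ) + (k : ℂ) * (ω₀ : ℂ))) • X k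
        = ∑ l ∈ Finset.Icc (-(n : ℤ)) n, tc (J (k - l)) (X l)) :
    ∀ k ∈ Finset.Icc (-(n : ℤ)) n, ‖X k‖ ≤ Real.exp (β * K) * Q * Real.exp (-β * |(k : ℝ)|) := by
  set s := Finset.Icc (-(n : ℤ)) n with hs
  have hne : s.Nonempty := ⟨0, by rw [hs, Finset.mem_Icc]; omega⟩
  obtain ⟨k₀, hk₀, hmax⟩ := s.exists_max_image (fun k => Real.exp (β * |(k : ℝ)|) * ‖X k‖) hne
  set T := Real.exp (β * |(k₀ : ℝ)|) * ‖X k₀‖ with hT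
  have hT0 : 0 ≤ T := by positivity
  have hXT : ∀ k ∈ s, ‖X k‖ ≤ T * Real.exp (-β * |(k : ℝ)|) := by
    intro k hk
    have h1 := hmax k hk
    have h2 : ‖X k‖ = (Real.exp (β * |(k : ℝ)|) * ‖X k‖) * Real.exp (-β * |(k : ℝ)|) := by
      rw [mul_right_comm, ← Real.exp_add]; simp
    rw [h2]
    exact mul_le_mul_of_nonneg_right h1 (Real.exp_pos _).le
  have hTb : T ≤ Real.exp (β * K) * Q := by
    by_cases hk : |(k₀ : ℝ)| ≤ K
    · have h1 : Real.exp (β * |(k₀ : ℝ)|) ≤ Real.exp (β * K) := by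
        rw [Real.exp_le_exp]; nlinarith
      exact mul_le_mul h1 (hX _ hk₀) (norm_nonneg _) (Real.exp_pos _).le
    · push Not at hk
      have hk0 : k₀ ≠ 0 := by
        rintro rfl
        simp at hk; linarith
      have h1 := congrArg norm (heq k₀ hk₀ hk0)
      have h2 : ‖Complex.I * ((ωf : ℂ) + (k₀ : ℂ) * (ω₀ : ℂ))‖ = |ωf + k₀ * ω₀| := by
        rw [norm_mul, Complex.norm_I, one_mul, ← Real.norm_eq_abs, ← Complex.norm_real]
        push_cast; rfl
      rw [norm_smul, h2] at h1
      have h3 : ‖∑ l ∈ s, tc (J (k₀ - l)) (X l)‖ ≤ C * T * Real.exp (-β * |(k₀ : ℝ)|) * G := by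
        calc _ ≤ ∑ l ∈ s, (C * T * Real.exp (-β * |(k₀ : ℝ)|)) *
                Real.exp (-(α - β) * |((k₀ - l : ℤ) : ℝ)|) := by
              refine norm_sum_le_of_le _ fun l hl => ?_
              calc _ ≤ opNorm (J (k₀ - l)) * ‖X l‖ := tc_le _ _
                _ ≤ (C * Real.exp (-α * |((k₀ - l : ℤ) : ℝ)|)) * (T * Real.exp (-β * |(l : ℝ)|)) :=
                    mul_le_mul (hJ _) (hXT l hl) (norm_nonneg _) (by positivity)
                _ = (C * T) * (Real.exp (-α * |((k₀ - l : ℤ) : ℝ)|) * Real.exp (-β * |(l : ℝ)|)) := by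
                    ring
                _ ≤ (C * T) * (Real.exp (-β * |(k₀ : ℝ)|) *
                      Real.exp (-(α - β) * |((k₀ - l : ℤ) : ℝ)|)) :=
                    mul_le_mul_of_nonneg_left (exp_kernel α β hβ _ _) (by positivity)
                _ = _ := by ring
          _ ≤ _ := by
              rw [← Finset.mul_sum]
              exact mul_le_mul_of_nonneg_left (hG _ _) (by positivity)
      have h4 := mul_le_mul_of_nonneg_right (hK k₀ hk) (norm_nonneg (X k₀))
      have h5 : 2 * C * G * ‖X k₀‖ ≤ C * G * ‖X k₀‖ := by
        calc _ ≤ _ := h4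
          _ ≤ _ := h1.le.trans h3
          _ = C * G * ‖X k₀‖ * (Real.exp (β * |(k₀ : ℝ)|) * Real.exp (-β * |(k₀ : ℝ)|)) := by
              rw [hT]; ring
          _ = _ := by rw [← Real.exp_add]; simp
      have h6 : 0 < C * G := by positivity
      have h7 : ‖X k₀‖ ≤ 0 := by nlinarith
      have h8 : ‖X k₀‖ = 0 := le_antisymm h7 (norm_nonneg _)
      rw [hT, h8, mul_zero]; positivity
  intro k hk
  exact (hXT k hk).trans (mul_le_mul_of_nonneg_right hTb (Real.exp_pos _).le)

lemma abs_opNorm_sub_le {a a' b : Type*} [Fintype a] [Fintype a'] [Fintype b] [DecidableEq b]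
    (A : Matrix a b ℂ) (D : Matrix a' b ℂ) (ε : ℝ) (hε : 0 ≤ ε)
    (h : ∀ u : EuclideanSpace ℂ b, |‖tc A u‖ - ‖tc D u‖| ≤ ε * ‖u‖) :
    |opNorm A - opNorm D| ≤ ε := by
  have h1 : opNorm A ≤ opNorm D + ε := by
    rw [← norm_tc A]
    refine ContinuousLinearMap.opNorm_le_bound _ (by linarith [opNorm_nonneg' A, opNorm_nonneg' D]) fun u => ?_
    have h2 := (abs_le.mp (h u)).2
    have h3 := tc_le D u
    linarith
  have h2 : opNorm D ≤ opNorm A + ε := by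
    rw [← norm_tc D]
    refine ContinuousLinearMap.opNorm_le_bound _ (by linarith [opNorm_nonneg' A, opNorm_nonneg' D]) fun u => ?_
    have h2 := (abs_le.mp (h u)).1
    have h3 := tc_le A u
    linarith
  rw [abs_le]; constructor <;> linarith

/-- **Cauchy property of the truncated harmonic resolvent gains.**
Under (J1) exponential decay of the Jacobian Fourier coefficients, (J2) exponential
convergence of the coefficients, and (J3) uniform invertibility of the truncations,
the largest singular values `σ₁(R^{(n)}) = ‖(L^{(n)})⁻¹ B^{(n)}‖₂` satisfy
`|σ₁(R^{(m)}) - σ₁(R^{(n)})| ≤ C₂ e^{-α' n}` for all `m > n`, for every `0 < α' < α`. -/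
theorem hr_gain_cauchy_exponential
    (d m : ℕ) (ω₀ ωf : ℝ) (hω₀ : 0 < ω₀)
    (B : Matrix (Fin d) (Fin m) ℂ) (C α M : ℝ) (hC : 0 < C) (hα : 0 < α) (hM : 0 < M)
    (J : ℕ → ℤ → Matrix (Fin d) (Fin d) ℂ)
    (hJ1 : ∀ n : ℕ, ∀ k : ℤ, opNorm (J n k) ≤ C * Real.exp (-α * |(k : ℝ)|))
    (hJ2 : ∀ n m' : ℕ, n ≤ m' → ∀ k : ℤ, |k| ≤ (n : ℤ) →
      opNorm (J m' k - J n k) ≤ C * Real.exp (-α * (n : ℝ)))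
    (hJ3 : ∀ n : ℕ, IsUnit (Lop d ω₀ ωf (J n) n) ∧ opNorm (Lop d ω₀ ωf (J n) n)⁻¹ ≤ M) :
    ∀ α' : ℝ, 0 < α' → α' < α → ∃ C₂ : ℝ, 0 < C₂ ∧ ∀ n m' : ℕ, n < m' →
      |opNorm ((Lop d ω₀ ωf (J m') m')⁻¹ * Bop d m B m')
        - opNorm ((Lop d ω₀ ωf (J n) n)⁻¹ * Bop d m B n)|
      ≤ C₂ * Real.exp (-α' * (n : ℝ)) := by
  intro α' hα' hαα
  obtain ⟨β, hβ1, hβ2⟩ := exists_between hαα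
  have hβ : 0 < β := hα'.trans hβ1
  obtain ⟨G, hG0, hG⟩ := hr_geom (α - β) (by linarith)
  obtain ⟨G₁, hG₁0, hG₁⟩ := hr_geom β hβ
  obtain ⟨G₂, hG₂0, hG₂⟩ := hr_geom (β - α') (by linarith)
  set K : ℝ := (2 * C * G + |ωf|) / ω₀ with hKdef
  have hK0 : 0 ≤ K := by positivity
  have hK : ∀ k : ℤ, K < |(k : ℝ)| → 2 * C * G ≤ |ωf + k * ω₀| := by
    intro k hk
    rw [hKdef, div_lt_iff₀ hω₀] at hk
    have h1 : |(k : ℝ) * ω₀| = |(k : ℝ)| * ω₀ := by rw [abs_mul, abs_of_pos hω₀]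
    have h2 : |(k : ℝ) * ω₀| ≤ |ωf + k * ω₀| + |ωf| := by
      have := abs_sub (ωf + k * ω₀) ωf
      simpa using this
    linarith
  set A : ℝ := Real.exp (β * K) * (M * opNorm B) with hA
  have hB0 := opNorm_nonneg' B
  have hA0 : 0 ≤ A := by positivity
  set A' : ℝ := C * A * G + 2 * C * A * G₁ with hA'
  have hA'0 : 0 ≤ A' := by positivity
  refine ⟨M * (A' * G₂) + 1, by positivity, fun n m' hnm => ?_⟩
  have key : |opNorm ((Lop d ω₀ ωf (J m') m')⁻¹ * Bop d m B m')
        - opNorm ((Lop d ω₀ ωf (J n) n)⁻¹ * Bop d m B n)|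
      ≤ M * (A' * G₂) * Real.exp (-α' * (n : ℝ)) := by
    refine abs_opNorm_sub_le _ _ _ (by positivity) fun u => ?_
    have hinv : ∀ N, Lop d ω₀ ωf (J N) N * (Lop d ω₀ ωf (J N) N)⁻¹ = 1 := fun N =>
      Matrix.mul_nonsing_inv _ ((Matrix.isUnit_iff_isUnit_det _).mp (hJ3 N).1)
    have hinv' : ∀ N, (Lop d ω₀ ωf (J N) N)⁻¹ * Lop d ω₀ ωf (J N) N = 1 := fun N =>
      Matrix.nonsing_inv_mul _ ((Matrix.isUnit_iff_isUnit_det _).mp (hJ3 N).1)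
    obtain ⟨X, hX, hXsupp⟩ := exists_res n (tc ((Lop d ω₀ ωf (J n) n)⁻¹ * Bop d m B n) u)
    have hL : tc (Lop d ω₀ ωf (J n) n) (res n X) = tc (Bop d m B n) u := by
      rw [hX, ← tc_mul, ← Matrix.mul_assoc, hinv, Matrix.one_mul]
    rw [tc_Lop, tc_Bop] at hL
    have hE := res_inj n _ _ hL
    have hBn : ‖tc (Bop d m B n) u‖ ≤ opNorm B * ‖u‖ := by
      rw [tc_Bop]
      refine (norm_res_le _ _).trans ?_
      rw [Finset.sum_eq_single 0]
      · simpa using tc_le B u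
      · intro b _ hb; simp [hb]
      · intro h; exact absurd (by rw [Finset.mem_Icc]; omega) h
    have hXn : ‖res n X‖ ≤ M * opNorm B * ‖u‖ := by
      rw [hX, tc_mul]
      calc _ ≤ _ := tc_le _ _
        _ ≤ M * (opNorm B * ‖u‖) := mul_le_mul (hJ3 n).2 hBn (norm_nonneg _) hM.le
        _ = _ := by ring
    have hdec0 := hr_decay ω₀ ωf C α β G (M * opNorm B * ‖u‖) hC hβ (by positivity) hG0 hG K hK0 hK
      (J n) n (hJ1 n) X (fun k hk => (le_norm_res n X k hk).trans hXn)
      (fun k hk hk0 => by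
        have := hE k hk
        simp only [hk0, if_false] at this
        exact sub_eq_zero.mp this)
    have hdec : ∀ k, ‖X k‖ ≤ A * ‖u‖ * Real.exp (-β * |(k : ℝ)|) := by
      intro k
      by_cases hk : k ∈ Finset.Icc (-(n : ℤ)) n
      · refine (hdec0 k hk).trans (le_of_eq ?_)
        rw [hA]; ring
      · rw [hXsupp k hk, norm_zero]; positivity
    have hsub : Finset.Icc (-(n : ℤ)) n ⊆ Finset.Icc (-(m' : ℤ)) m' := by
      apply Finset.Icc_subset_Icc <;> omega
    have hnorm : ‖res m' X‖ = ‖res n X‖ := by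
      rw [← sq_eq_sq₀ (norm_nonneg _) (norm_nonneg _), norm_res_sq, norm_res_sq]
      refine (Finset.sum_subset hsub fun k _ hk => ?_).symm
      rw [hXsupp k hk]; simp
    set r : ℤ → EuclideanSpace ℂ (Fin d) := fun k =>
      ((Complex.I * ((ωf : ℂ) + (k : ℂ) * (ω₀ : ℂ))) • X k
        - ∑ l ∈ Finset.Icc (-(m' : ℤ)) m', tc (J m' (k - l)) (X l))
        - (if k = 0 then tc B u else 0) with hr
    have hres : tc (Lop d ω₀ ωf (J m') m') (res m' X) - tc (Bop d m B m') u = res m' r := by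
      rw [tc_Lop, tc_Bop, res_sub]
    have hsum : ∀ k, ∑ l ∈ Finset.Icc (-(m' : ℤ)) m', tc (J m' (k - l)) (X l)
        = ∑ l ∈ Finset.Icc (-(n : ℤ)) n, tc (J m' (k - l)) (X l) := by
      intro k
      refine (Finset.sum_subset hsub fun l _ hl => ?_).symm
      rw [hXsupp l hl, map_zero]
    have hrb : ∀ k, ‖r k‖ ≤ A' * ‖u‖ * Real.exp (-α' * (n : ℝ))
        * Real.exp (-(β - α') * |((0 - k : ℤ) : ℝ)|) := by
      intro k
      have habs : |((0 - k : ℤ) : ℝ)| = |(k : ℝ)| := by push_cast; simp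
      rw [habs]
      by_cases hk : k ∈ Finset.Icc (-(n : ℤ)) n
      · have hkn : |(k : ℝ)| ≤ n := by
          rw [Finset.mem_Icc] at hk
          rw [abs_le]; constructor
          · exact_mod_cast hk.1
          · exact_mod_cast hk.2
        have h1 : r k = ∑ l ∈ Finset.Icc (-(n : ℤ)) n, tc (J n (k - l) - J m' (k - l)) (X l) := by
          have h2 := hE k hk
          simp only [hr, hsum, ← h2, tc_sub, Finset.sum_sub_distrib]
          abel
        have hJd : ∀ j : ℤ, ∀ v, ‖tc (J n j - J m' j) v‖
            ≤ 2 * C * Real.exp (-α * (n : ℝ)) * ‖v‖ := by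
          intro j v
          by_cases hj : |j| ≤ (n : ℤ)
          · have h2 := tc_le (J m' j - J n j) v
            have h3 := mul_le_mul_of_nonneg_right (hJ2 n m' hnm.le j hj) (norm_nonneg v)
            rw [tc_sub, norm_sub_rev, ← tc_sub]
            have h4 : 0 ≤ C * Real.exp (-α * (n : ℝ)) * ‖v‖ := by positivity
            linarith
          · push Not at hj
            have hj' : (n : ℝ) ≤ |(j : ℝ)| := by exact_mod_cast hj.le
            have h5 : Real.exp (-α * |(j : ℝ)|) ≤ Real.exp (-α * (n : ℝ)) := by
              rw [Real.exp_le_exp]; nlinarith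
            have h6 : ∀ N, ‖tc (J N j) v‖ ≤ C * Real.exp (-α * (n : ℝ)) * ‖v‖ := fun N =>
              (tc_le _ _).trans (mul_le_mul_of_nonneg_right
                ((hJ1 N j).trans (mul_le_mul_of_nonneg_left h5 hC.le)) (norm_nonneg v))
            rw [tc_sub]
            have := norm_sub_le (tc (J n j) v) (tc (J m' j) v)
            linarith [h6 n, h6 m']
        have h7 : ‖r k‖ ≤ 2 * C * Real.exp (-α * (n : ℝ)) * (A * ‖u‖) * G₁ := by
          rw [h1]
          calc _ ≤ ∑ l ∈ Finset.Icc (-(n : ℤ)) n, 2 * C * Real.exp (-α * (n : ℝ)) * (A * ‖u‖) *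
                Real.exp (-β * |((0 - l : ℤ) : ℝ)|) := by
                refine norm_sum_le_of_le _ fun l hl => ?_
                have habs : |((0 - l : ℤ) : ℝ)| = |(l : ℝ)| := by push_cast; simp
                rw [habs]
                refine (hJd _ _).trans ?_
                rw [mul_assoc (2 * C * Real.exp (-α * (n : ℝ)))]
                exact mul_le_mul_of_nonneg_left (hdec l) (by positivity)
            _ ≤ _ := by
                rw [← Finset.mul_sum]
                exact mul_le_mul_of_nonneg_left (hG₁ _ _) (by positivity)
        have h8 : Real.exp (-α * (n : ℝ))
            ≤ Real.exp (-α' * (n : ℝ)) * Real.exp (-(β - α') * |(k : ℝ)|) := by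
          rw [← Real.exp_add, Real.exp_le_exp]
          have hn : (0 : ℝ) ≤ n := Nat.cast_nonneg n
          nlinarith
        calc _ ≤ _ := h7
          _ = (2 * C * A * G₁ * ‖u‖) * Real.exp (-α * (n : ℝ)) := by ring
          _ ≤ (A' * ‖u‖) * (Real.exp (-α' * (n : ℝ)) * Real.exp (-(β - α') * |(k : ℝ)|)) := by
              refine mul_le_mul ?_ h8 (Real.exp_pos _).le (by positivity)
              refine mul_le_mul_of_nonneg_right ?_ (norm_nonneg u)
              have : 0 ≤ C * A * G := by positivity
              rw [hA']; linarith
          _ = _ := by ring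
      · have hkn : (n : ℝ) ≤ |(k : ℝ)| := by
          have : (n : ℤ) ≤ |k| := by
            rw [Finset.mem_Icc, not_and_or] at hk
            rw [le_abs]; omega
          exact_mod_cast this
        have hk0 : k ≠ 0 := by
          rintro rfl
          exact hk (by rw [Finset.mem_Icc]; omega)
        have h1 : ‖r k‖ = ‖∑ l ∈ Finset.Icc (-(n : ℤ)) n, tc (J m' (k - l)) (X l)‖ := by
          simp only [hr, hsum, hXsupp k hk, hk0, if_false, smul_zero, zero_sub, sub_zero, norm_neg]
        have h7 : ‖r k‖ ≤ C * (A * ‖u‖) * Real.exp (-β * |(k : ℝ)|) * G := by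
          rw [h1]
          calc _ ≤ ∑ l ∈ Finset.Icc (-(n : ℤ)) n, (C * (A * ‖u‖) * Real.exp (-β * |(k : ℝ)|)) *
                Real.exp (-(α - β) * |((k - l : ℤ) : ℝ)|) := by
                refine norm_sum_le_of_le _ fun l hl => ?_
                calc _ ≤ opNorm (J m' (k - l)) * ‖X l‖ := tc_le _ _
                  _ ≤ (C * Real.exp (-α * |((k - l : ℤ) : ℝ)|)) *
                        (A * ‖u‖ * Real.exp (-β * |(l : ℝ)|)) :=
                      mul_le_mul (hJ1 _ _) (hdec l) (norm_nonneg _) (by positivity)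
                  _ = (C * (A * ‖u‖)) * (Real.exp (-α * |((k - l : ℤ) : ℝ)|)
                        * Real.exp (-β * |(l : ℝ)|)) := by ring
                  _ ≤ (C * (A * ‖u‖)) * (Real.exp (-β * |(k : ℝ)|) *
                        Real.exp (-(α - β) * |((k - l : ℤ) : ℝ)|)) :=
                      mul_le_mul_of_nonneg_left (exp_kernel α β hβ _ _) (by positivity)
                  _ = _ := by ring
            _ ≤ _ := by
                rw [← Finset.mul_sum]
                exact mul_le_mul_of_nonneg_left (hG _ _) (by positivity)
        have h8 : Real.exp (-β * |(k : ℝ)|)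
            ≤ Real.exp (-α' * (n : ℝ)) * Real.exp (-(β - α') * |(k : ℝ)|) := by
          rw [← Real.exp_add, Real.exp_le_exp]
          nlinarith
        calc _ ≤ _ := h7
          _ = (C * A * G * ‖u‖) * Real.exp (-β * |(k : ℝ)|) := by ring
          _ ≤ (A' * ‖u‖) * (Real.exp (-α' * (n : ℝ)) * Real.exp (-(β - α') * |(k : ℝ)|)) := by
              refine mul_le_mul ?_ h8 (Real.exp_pos _).le (by positivity)
              refine mul_le_mul_of_nonneg_right ?_ (norm_nonneg u)
              have : 0 ≤ 2 * C * A * G₁ := by positivity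
              rw [hA']; linarith
          _ = _ := by ring
    have hrn : ‖res m' r‖ ≤ A' * ‖u‖ * Real.exp (-α' * (n : ℝ)) * G₂ := by
      refine (norm_res_le _ _).trans ((Finset.sum_le_sum fun k _ => hrb k).trans ?_)
      rw [← Finset.mul_sum]
      exact mul_le_mul_of_nonneg_left (hG₂ _ _) (by positivity)
    have hdiff : tc ((Lop d ω₀ ωf (J m') m')⁻¹) (res m' r)
        = res m' X - tc ((Lop d ω₀ ωf (J m') m')⁻¹ * Bop d m B m') u := by
      rw [← hres, map_sub, ← tc_mul, ← tc_mul, hinv', tc_one]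
    rw [← hX, ← hnorm]
    calc _ ≤ _ := abs_norm_sub_norm_le _ _
      _ = ‖tc ((Lop d ω₀ ωf (J m') m')⁻¹) (res m' r)‖ := by rw [hdiff, norm_sub_rev]
      _ ≤ _ := tc_le _ _
      _ ≤ M * (A' * ‖u‖ * Real.exp (-α' * (n : ℝ)) * G₂) :=
          mul_le_mul (hJ3 m').2 hrn (norm_nonneg _) hM.le
      _ = _ := by ring
  refine key.trans (mul_le_mul_of_nonneg_right (by linarith) (Real.exp_pos _).le)
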